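/- arXiv:math/0205009 — 3 statements merged into one kernel-verified Lean document; each statement's English description precedes it below -/
import Mathlib

section
/- Let g ≥ 0 and n ≥ 4 be integers and S ⊆ {1,…,n} a subset with 2 ≤ |S| ≤ n−2. Let D = D_{g,n} ⊆ ℝ^n be the domain of admissible weight data and w_S = {a ∈ D : Σ_{j∈S} a_j = 1}. If w_S is nonempty, then the two sets D⁺ = {a ∈ D : Σ_{j∈S} a_j > 1} and D⁻ = {a ∈ D : Σ_{j∈S} a_j < 1} are both nonempty and convex (hence connected), they are disjoint with union D \ w_S, and they are exactly the two connected components of the topological subspace D \ w_S of ℝ^n. -/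
open Finset

theorem connectedComponentIn_eq_inter_of_subset_union {X : Type*} [TopologicalSpace X]
    {F u v : Set X} (hu : IsOpen u) (hv : IsOpen v) (huv : Disjoint u v) (hF : F ⊆ u ∪ v)
    (hc : IsPreconnected (F ∩ u)) {x : X} (hx : x ∈ F ∩ u) :
    connectedComponentIn F x = F ∩ u := by
  apply Set.Subset.antisymm
  · exact Set.subset_inter (connectedComponentIn_subset F x)
      (isPreconnected_connectedComponentIn.subset_left_of_subset_union hu hv huv
        ((connectedComponentIn_subset F x).trans hF)
        ⟨x, mem_connectedComponentIn hx.1, hx.2⟩)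
  · exact hc.subset_connectedComponentIn hx Set.inter_subset_left

/-- Removing a level set of a continuous linear functional from a convex set leaves at most two
connected components, cut out by the strict inequalities. -/
theorem Convex.connectedComponentIn_diff_level {E : Type*} [AddCommGroup E] [Module ℝ E]
    [TopologicalSpace E] [IsTopologicalAddGroup E] [ContinuousSMul ℝ E]
    {D : Set E} (hD : Convex ℝ D) (f : E →L[ℝ] ℝ) (c : ℝ) :
    (∀ x ∈ {a ∈ D | c < f a},
      connectedComponentIn (D \ {a ∈ D | f a = c}) x = {a ∈ D | c < f a}) ∧
    (∀ x ∈ {a ∈ D | f a < c},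
      connectedComponentIn (D \ {a ∈ D | f a = c}) x = {a ∈ D | f a < c}) := by
  have hgt : IsOpen {a | c < f a} := isOpen_lt continuous_const f.continuous
  have hlt : IsOpen {a | f a < c} := isOpen_lt f.continuous continuous_const
  have hdisj : Disjoint {a | c < f a} {a | f a < c} :=
    Set.disjoint_left.2 fun a (h : c < f a) (h' : f a < c) => lt_asymm h h'
  have hcover : D \ {a ∈ D | f a = c} ⊆ {a | c < f a} ∪ {a | f a < c} := fun a ha =>
    (lt_or_gt_of_ne fun h => ha.2 ⟨ha.1, h⟩).symm
  have hplus : {a ∈ D | c < f a} = (D \ {a ∈ D | f a = c}) ∩ {a | c < f a} := by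
    ext a
    exact ⟨fun h => ⟨⟨h.1, fun h' => h.2.ne' h'.2⟩, h.2⟩, fun h => ⟨h.1.1, h.2⟩⟩
  have hminus : {a ∈ D | f a < c} = (D \ {a ∈ D | f a = c}) ∩ {a | f a < c} := by
    ext a
    exact ⟨fun h => ⟨⟨h.1, fun h' => h.2.ne h'.2⟩, h.2⟩, fun h => ⟨h.1.1, h.2⟩⟩
  have hcplus : IsPreconnected {a ∈ D | c < f a} :=
    (hD.inter (convex_halfSpace_gt f.toLinearMap.isLinear c)).isPreconnected
  have hcminus : IsPreconnected {a ∈ D | f a < c} :=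
    (hD.inter (convex_halfSpace_lt f.toLinearMap.isLinear c)).isPreconnected
  rw [hplus] at hcplus ⊢
  rw [hminus] at hcminus ⊢
  exact ⟨fun x hx => connectedComponentIn_eq_inter_of_subset_union hgt hlt hdisj hcover hcplus hx,
    fun x hx => connectedComponentIn_eq_inter_of_subset_union hlt hgt hdisj.symm
      (by rwa [Set.union_comm]) hcminus hx⟩

/-- The sum of the coordinates in `S`, as a continuous linear functional. -/
noncomputable def coordSum {ι : Type*} (S : Finset ι) : (ι → ℝ) →L[ℝ] ℝ :=
  ∑ j ∈ S, ContinuousLinearMap.proj j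

theorem coordSum_apply {ι : Type*} (S : Finset ι) (a : ι → ℝ) :
    coordSum S a = ∑ j ∈ S, a j := by
  simp [coordSum]

theorem convex_weightDomain {ι : Type*} [Fintype ι] (c : ℝ) :
    Convex ℝ {a : ι → ℝ | (∀ j, 0 < a j ∧ a j ≤ 1) ∧ c < ∑ j, a j} := by
  have hbox : Convex ℝ (Set.univ.pi fun _ : ι => Set.Ioc (0 : ℝ) 1) :=
    convex_pi fun _ _ => convex_Ioc 0 1
  have hsum : Convex ℝ {a | c < coordSum (univ : Finset ι) a} :=
    convex_halfSpace_gt (coordSum univ).toLinearMap.isLinear c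
  convert hbox.inter hsum using 1
  ext a
  simp [coordSum_apply]

/-- Given a nonempty wall `w_S` (with `2 ≤ |S| ≤ n−2`) in the domain of admissible
weight data `D = D_{g,n} ⊆ ℝⁿ`, the sets `D⁺ = {a ∈ D : Σ_{j∈S} a_j > 1}` and
`D⁻ = {a ∈ D : Σ_{j∈S} a_j < 1}` are nonempty and convex, disjoint with union
`D \ w_S`, and are exactly the two connected components of the subspace `D \ w_S`. -/
theorem stmt4 (g n : ℕ) (hn : 4 ≤ n) (S : Finset (Fin n)) (hS2 : 2 ≤ S.card)
    (hSn : S.card ≤ n - 2)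
    (D : Set (Fin n → ℝ))
    (hD : D = {a | (∀ j, 0 < a j ∧ a j ≤ 1) ∧ 2 - 2 * (g : ℝ) < ∑ j, a j})
    (w : Set (Fin n → ℝ)) (hw : w = {a ∈ D | ∑ j ∈ S, a j = 1})
    (hne : w.Nonempty)
    (Dplus Dminus : Set (Fin n → ℝ))
    (hp : Dplus = {a ∈ D | 1 < ∑ j ∈ S, a j})
    (hm : Dminus = {a ∈ D | ∑ j ∈ S, a j < 1}) :
    Dplus.Nonempty ∧ Dminus.Nonempty ∧ Convex ℝ Dplus ∧ Convex ℝ Dminus ∧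
    Disjoint Dplus Dminus ∧ Dplus ∪ Dminus = D \ w ∧
    (∀ x ∈ Dplus, connectedComponentIn (D \ w) x = Dplus) ∧
    (∀ x ∈ Dminus, connectedComponentIn (D \ w) x = Dminus) := by
  have hconv : Convex ℝ D := hD ▸ convex_weightDomain _
  have hn' : (4 : ℝ) ≤ n := by exact_mod_cast hn
  have hg : (0 : ℝ) ≤ g := g.cast_nonneg
  have hS2' : (2 : ℝ) ≤ S.card := by exact_mod_cast hS2
  have hSn' : (S.card : ℝ) + 2 ≤ n := by
    have : S.card + 2 ≤ n := by omega
    exact_mod_cast this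
  have hcomp := hconv.connectedComponentIn_diff_level (coordSum S) 1
  have hcplus := hconv.inter (convex_halfSpace_gt (coordSum S).toLinearMap.isLinear 1)
  have hcminus := hconv.inter (convex_halfSpace_lt (coordSum S).toLinearMap.isLinear 1)
  simp only [ContinuousLinearMap.coe_coe, coordSum_apply] at hcomp hcplus hcminus
  rw [← hw, ← hp, ← hm] at hcomp
  refine ⟨?_, ?_, hp ▸ hcplus, hm ▸ hcminus, ?_, ?_, hcomp.1, hcomp.2⟩
  · refine ⟨fun _ => 1, ?_⟩
    rw [hp, hD]
    refine ⟨⟨fun _ => by norm_num, ?_⟩, ?_⟩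
    · simp only [sum_const, card_univ, Fintype.card_fin, nsmul_eq_mul, mul_one]
      linarith
    · simp only [sum_const, nsmul_eq_mul, mul_one]
      linarith
  · have hn0 : (0 : ℝ) < n := by linarith
    have hS : ∑ j ∈ S, (if j ∈ S then (n : ℝ)⁻¹ else 1) = S.card * (n : ℝ)⁻¹ := by
      rw [sum_congr rfl fun j hj => if_pos hj, sum_const, nsmul_eq_mul]
    have hSc : ∑ j ∈ Sᶜ, (if j ∈ S then (n : ℝ)⁻¹ else 1) = n - S.card := by
      rw [sum_congr rfl fun j hj => if_neg (mem_compl.1 hj), sum_const, nsmul_eq_mul, mul_one,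
        card_compl, Fintype.card_fin, Nat.cast_sub (by omega)]
    refine ⟨fun j => if j ∈ S then (n : ℝ)⁻¹ else 1, ?_⟩
    rw [hm, hD]
    refine ⟨⟨fun j => ?_, ?_⟩, ?_⟩
    · dsimp only
      split_ifs
      · exact ⟨inv_pos.2 hn0, inv_le_one_of_one_le₀ (by linarith)⟩
      · norm_num
    · rw [← sum_add_sum_compl S, hS, hSc]
      have : 0 < S.card * (n : ℝ)⁻¹ := mul_pos (by linarith) (inv_pos.2 hn0)
      linarith
    · rw [hS, ← div_eq_mul_inv, div_lt_one hn0]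
      linarith
  · rw [hp, hm]
    exact Set.disjoint_left.2 fun a h h' => lt_asymm h.2 h'.2
  · rw [hp, hm, hw]
    ext a
    simp only [Set.mem_union, Set.mem_sdiff, Set.mem_ofPred_eq]
    grind
end

section
/- Let A be a commutative ring, R a commutative A-algebra with module of Kähler differentials Ω_{R/A} and universal derivation d, and let f_1,…,f_n ∈ R be non-zero-divisors. Let Ω⟨f_1,…,f_n⟩ = (Ω_{R/A} ⊕ R^n)/N, where N is the R-submodule generated by the elements (d f_j, −f_j·e_j) for j = 1,…,n. Then: (i) the R-linear map ι : Ω_{R/A} → Ω⟨f_1,…,f_n⟩ sending ω to the class of (ω, 0) is injective; (ii) the R-linear map res : Ω⟨f_1,…,f_n⟩ → ⊕_{j=1}^n R/(f_j), sending the class of (ω, (r_1,…,r_n)) to (r_1 mod (f_1), …, r_n mod (f_n)), is well defined and surjective; and (iii) the kernel of res equals the image of ι. In other words, the sequence 0 → Ω_{R/A} → Ω⟨f_1,…,f_n⟩ → ⊕_{j=1}^n R/(f_j) → 0 is exact. -/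
noncomputable section

/-- The module of differentials of an `A`-algebra `R` with logarithmic poles
along `f_1,…,f_n ∈ R`: the quotient of `Ω_{R/A} ⊕ Rⁿ` by the submodule generated
by the elements `(d f_j, −f_j·e_j)`. -/
def logRel (A R : Type*) [CommRing A] [CommRing R] [Algebra A R] {n : ℕ}
    (f : Fin n → R) : Submodule R ((Ω[R⁄A]) × (Fin n → R)) :=
  Submodule.span R
    (Set.range fun j : Fin n =>
      ((KaehlerDifferential.D A R (f j), -(f j) • (Pi.single j (1 : R) : Fin n → R)) :
        (Ω[R⁄A]) × (Fin n → R)))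

/-- `Ω⟨f_1,…,f_n⟩ = (Ω_{R/A} ⊕ Rⁿ) / ⟨(d f_j, −f_j·e_j)⟩`. -/
abbrev LogDiff (A R : Type*) [CommRing A] [CommRing R] [Algebra A R] {n : ℕ}
    (f : Fin n → R) :=
  ((Ω[R⁄A]) × (Fin n → R)) ⧸ logRel A R f

/-- The canonical map `Ω_{R/A} → Ω⟨f_1,…,f_n⟩`, `ω ↦ [(ω, 0)]`. -/
def logIota (A R : Type*) [CommRing A] [CommRing R] [Algebra A R] {n : ℕ}
    (f : Fin n → R) : (Ω[R⁄A]) →ₗ[R] LogDiff A R f :=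
  (logRel A R f).mkQ ∘ₗ LinearMap.inl R (Ω[R⁄A]) (Fin n → R)

/-- Elements of `logRel` are the pairs `(∑ c_j d f_j, (−c_j f_j)_j)`. -/
theorem mem_logRel_iff (A R : Type*) [CommRing A] [CommRing R] [Algebra A R] {n : ℕ}
    (f : Fin n → R) (ω : Ω[R⁄A]) (r : Fin n → R) :
    (ω, r) ∈ logRel A R f ↔
      ∃ c : Fin n → R, ∑ j, c j • KaehlerDifferential.D A R (f j) = ω ∧
        ∀ j, -(c j * f j) = r j := by
  rw [logRel, Submodule.mem_span_range_iff_exists_fun]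
  simp only [Prod.ext_iff, Prod.fst_sum, Prod.snd_sum, Prod.smul_fst, Prod.smul_snd,
    funext_iff, Finset.sum_apply, Pi.smul_apply, Pi.single_apply, smul_eq_mul,
    mul_ite, mul_one, mul_zero, Finset.sum_ite_eq, Finset.mem_univ, if_true, mul_neg]

/-- The residue map `[(ω, r)] ↦ (r_j mod (f_j))_j`. -/
def logRes (A R : Type*) [CommRing A] [CommRing R] [Algebra A R] {n : ℕ}
    (f : Fin n → R) : LogDiff A R f →ₗ[R] ((j : Fin n) → R ⧸ Ideal.span {f j}) :=
  (logRel A R f).liftQ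
    (LinearMap.pi fun j =>
      (Ideal.span {f j}).mkQ ∘ₗ LinearMap.proj j ∘ₗ LinearMap.snd R (Ω[R⁄A]) (Fin n → R)) <| by
    rintro ⟨ω, r⟩ h
    obtain ⟨c, -, hc⟩ := (mem_logRel_iff A R f ω r).1 h
    rw [LinearMap.mem_ker]
    funext j
    refine (Submodule.Quotient.mk_eq_zero _).2 (Ideal.mem_span_singleton'.2 ⟨-c j, ?_⟩)
    rw [neg_mul]
    exact hc j

/-- The residuation exact sequence
`0 → Ω_{R/A} → Ω⟨f_1,…,f_n⟩ → ⊕_j R/(f_j) → 0` for non-zero-divisors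
`f_1,…,f_n`: the map `ι : ω ↦ [(ω,0)]` is injective, the residue map
`res : [(ω, r)] ↦ (r_j mod (f_j))_j` is a well-defined surjective `R`-linear
map, and `ker res = im ι`. -/
theorem residuation_exact (A R : Type*) [CommRing A] [CommRing R] [Algebra A R]
    {n : ℕ} (f : Fin n → R) (hf : ∀ j, f j ∈ nonZeroDivisors R) :
    Function.Injective (logIota A R f) ∧
    ∃ res : LogDiff A R f →ₗ[R] ((j : Fin n) → R ⧸ Ideal.span {f j}),
      (∀ (ω : Ω[R⁄A]) (r : Fin n → R),
        res (Submodule.Quotient.mk (ω, r)) =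
          fun j => Ideal.Quotient.mk (Ideal.span {f j}) (r j)) ∧
      Function.Surjective res ∧
      LinearMap.ker res = LinearMap.range (logIota A R f) := by
  refine ⟨?_, logRes A R f, fun _ _ => rfl, ?_, ?_⟩
  · refine (injective_iff_map_eq_zero _).2 fun ω h => ?_
    obtain ⟨c, hω, hc⟩ := (mem_logRel_iff A R f ω 0).1 ((Submodule.Quotient.mk_eq_zero _).1 h)
    have hc0 : ∀ j, c j = 0 := fun j =>
      (mul_right_mem_nonZeroDivisors_eq_zero_iff (hf j)).1 (neg_eq_zero.1 (hc j))
    simpa [hc0] using hω.symm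
  · intro y
    choose r hr using fun j => Ideal.Quotient.mk_surjective (y j)
    exact ⟨Submodule.Quotient.mk (0, r), funext hr⟩
  · ext x
    obtain ⟨⟨ω, r⟩, rfl⟩ := Submodule.Quotient.mk_surjective _ x
    rw [LinearMap.mem_ker, LinearMap.mem_range]
    constructor
    · intro h
      have hr : ∀ j, ∃ c, c * f j = r j := fun j =>
        Ideal.mem_span_singleton'.1 ((Submodule.Quotient.mk_eq_zero _).1 (congrFun h j))
      choose c hc using hr
      refine ⟨ω + ∑ j, c j • KaehlerDifferential.D A R (f j),
        (Submodule.Quotient.eq _).2 ((mem_logRel_iff A R f _ _).2 ⟨c, ?_, fun j => ?_⟩)⟩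
      · simp
      · simp [hc]
    · rintro ⟨η, h⟩
      rw [← h]
      funext j
      exact map_zero (Ideal.Quotient.mk (Ideal.span {f j}))
end
end

section
/- Let A be a commutative ring, R a commutative A-algebra, and f_1,…,f_n, g_1,…,g_n ∈ R with f_j = u_j·g_j for units u_j ∈ Rˣ. Then there is an R-module isomorphism φ : Ω⟨g_1,…,g_n⟩ → Ω⟨f_1,…,f_n⟩ which commutes with the canonical maps from Ω_{R/A} (i.e., φ sends the class of (ω,0) to the class of (ω,0)); explicitly, φ sends the class of (ω, (r_1,…,r_n)) to the class of (ω − Σ_j r_j·u_j^{−1}·d u_j, (r_1,…,r_n)). -/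
noncomputable section

/-- The shear `(ω, r) ↦ (ω - L r, r)` of a product of modules. -/
def subShear {R M N : Type*} [Ring R] [AddCommGroup M] [Module R M] [AddCommGroup N] [Module R N]
    (L : N →ₗ[R] M) : (M × N) ≃ₗ[R] (M × N) where
  toFun x := (x.1 - L x.2, x.2)
  invFun x := (x.1 + L x.2, x.2)
  map_add' x y := by ext <;> simp [add_sub_add_comm]
  map_smul' c x := by ext <;> simp [smul_sub]
  left_inv x := by simp
  right_inv x := by simp

/-- The linear map `r ↦ Σ_j (r_j·u_j⁻¹)·d u_j`. -/
def sumDlog (A : Type*) {R : Type*} [CommRing A] [CommRing R] [Algebra A R] {n : ℕ}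
    (u : Fin n → Rˣ) : (Fin n → R) →ₗ[R] Ω[R⁄A] where
  toFun r := ∑ j, (r j * ((u j)⁻¹ : Rˣ)) • KaehlerDifferential.D A R (u j : R)
  map_add' r s := by simp [add_mul, add_smul, Finset.sum_add_distrib]
  map_smul' c r := by simp [Finset.smul_sum, mul_smul]

lemma sumDlog_single (A : Type*) {R : Type*} [CommRing A] [CommRing R] [Algebra A R] {n : ℕ}
    (u : Fin n → Rˣ) (j : Fin n) :
    sumDlog A u (Pi.single j 1) = ((u j)⁻¹ : Rˣ).val • KaehlerDifferential.D A R (u j : R) := by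
  change ∑ k, ((Pi.single j 1 : Fin n → R) k * ((u k)⁻¹ : Rˣ)) •
    KaehlerDifferential.D A R (u k : R) = _
  rw [Finset.sum_eq_single j]
  · simp
  · intro k _ hk
    simp [hk]
  · simp

lemma smul_subShear_sumDlog (A : Type*) {R : Type*} [CommRing A] [CommRing R] [Algebra A R]
    {n : ℕ} (u : Fin n → Rˣ) (j : Fin n) (a : R) :
    (u j : R) • subShear (sumDlog A u)
        (KaehlerDifferential.D A R a, -a • (Pi.single j (1 : R) : Fin n → R)) =
      (KaehlerDifferential.D A R (u j * a),
        -(u j * a) • (Pi.single j (1 : R) : Fin n → R)) := by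
  change (u j : R) • (_ - sumDlog A u (-a • Pi.single j 1), _) = _
  rw [map_smul, sumDlog_single, Prod.smul_mk]
  refine Prod.ext ?_ ?_
  · simp only [Derivation.leibniz, smul_sub, smul_smul]
    rw [mul_left_comm, Units.mul_inv, mul_one, neg_smul, sub_neg_eq_add]
  · simp only [smul_smul, mul_neg]

lemma map_subShear_logRel (A : Type*) {R : Type*} [CommRing A] [CommRing R] [Algebra A R]
    {n : ℕ} (f g : Fin n → R) (u : Fin n → Rˣ) (hfg : ∀ j, f j = (u j : R) * g j) :
    (logRel A R g).map (subShear (sumDlog A u)).toLinearMap = logRel A R f := by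
  rw [logRel, Submodule.map_span, ← Set.range_comp]
  refine le_antisymm (Submodule.span_le.2 ?_) (Submodule.span_le.2 ?_)
  · rintro _ ⟨j, rfl⟩
    refine ((logRel A R f).smul_mem_iff_of_isUnit (u j).isUnit).1 ?_
    refine Submodule.subset_span ⟨j, ?_⟩
    simp only [hfg]
    exact (smul_subShear_sumDlog A u j (g j)).symm
  · rintro _ ⟨j, rfl⟩
    simp only [hfg, ← smul_subShear_sumDlog]
    exact Submodule.smul_mem _ _ (Submodule.subset_span ⟨j, rfl⟩)

/-- Independence of `Ω⟨f_1,…,f_n⟩` of the choice of defining equations: if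
`f_j = u_j·g_j` with `u_j ∈ Rˣ`, then there is an `R`-module isomorphism
`φ : Ω⟨g_1,…,g_n⟩ ≃ Ω⟨f_1,…,f_n⟩` commuting with the canonical maps from
`Ω_{R/A}`, given explicitly by
`[(ω, r)] ↦ [(ω − Σ_j (r_j·u_j⁻¹)·d u_j, r)]`. -/
theorem logDiff_indep (A R : Type*) [CommRing A] [CommRing R] [Algebra A R]
    {n : ℕ} (f g : Fin n → R) (u : Fin n → Rˣ)
    (hfg : ∀ j, f j = (u j : R) * g j) :
    ∃ φ : LogDiff A R g ≃ₗ[R] LogDiff A R f,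
      (∀ (ω : Ω[R⁄A]) (r : Fin n → R),
        φ (Submodule.Quotient.mk (ω, r)) =
          Submodule.Quotient.mk
            (ω - ∑ j, (r j * ((u j)⁻¹ : Rˣ)) • KaehlerDifferential.D A R (u j : R), r)) ∧
      (∀ ω : Ω[R⁄A],
        φ (Submodule.Quotient.mk (ω, (0 : Fin n → R))) =
          Submodule.Quotient.mk (ω, (0 : Fin n → R))) := by
  refine ⟨Submodule.Quotient.equiv _ _ (subShear (sumDlog A u))
    (map_subShear_logRel A f g u hfg), fun ω r => rfl, fun ω => ?_⟩
  change Submodule.Quotient.mk (ω - sumDlog A u 0, 0) = _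
  rw [map_zero, sub_zero]
end
end
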